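/- Let V ⊂ ℝ² be a one-dimensional linear subspace such that V + ℤ² is dense in ℝ², and let q: ℝ² → ℝ²/V ≅ ℝ be the quotient map (a surjective linear map with kernel V). Let g̃: ℝ² → ℝ² be a homeomorphism such that (a) g̃(x + m) − g̃(x) ∈ ℤ² for every x ∈ ℝ² and every m ∈ ℤ² (g̃ is a lift of a homeomorphism of the torus ℝ²/ℤ²), and (b) g̃ maps each coset x + V onto a coset of V. Then the induced map G: ℝ → ℝ determined by q ∘ g̃ = G ∘ q is affine: there exist a, b ∈ ℝ with G(t) = a t + b for all t. -/

import Mathlib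

/-- A continuous integer-valued real function on a preconnected space is constant. -/
theorem Continuous.eq_of_forall_exists_int {X : Type*} [TopologicalSpace X] [PreconnectedSpace X]
    {f : X → ℝ} (hf : Continuous f) (hint : ∀ x, ∃ k : ℤ, f x = k) (x y : X) : f x = f y := by
  choose k hk using hint
  have hkc : Continuous k := by
    rw [Int.isClosedEmbedding_coe_real.isEmbedding.isInducing.continuous_iff]
    convert hf using 1
    exact funext fun z => (hk z).symm
  rw [hk x, hk y, PreconnectedSpace.constant ‹_› hkc (x := x) (y := y)]

/-- A continuous real function whose increments over a dense set of steps do not depend on the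
base point is affine. -/
theorem Continuous.affine_of_dense_increments {G : ℝ → ℝ} (hG : Continuous G) {S : Set ℝ}
    (hS : Dense S) (hinc : ∀ s ∈ S, ∀ t, G (t + s) - G t = G s - G 0) :
    ∃ a b : ℝ, ∀ t, G t = a * t + b := by
  have hall : ∀ t s, G (t + s) - G t = G s - G 0 := fun t s =>
    congrFun (Continuous.ext_on hS (f := fun s => G (t + s) - G t) (g := fun s => G s - G 0)
      (by fun_prop) (by fun_prop) fun s hs => hinc s hs t) s
  let A : ℝ →+ ℝ := AddMonoidHom.mk' (fun t => G t - G 0) fun t s => by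
    linarith [hall t s]
  have hA : Continuous A := hG.sub continuous_const
  refine ⟨G 1 - G 0, G 0, fun t => ?_⟩
  have h : A (t • (1 : ℝ)) = t • A 1 := map_real_smul A hA t 1
  have h' : G t - G 0 = t * (G 1 - G 0) := by simpa [A] using h
  linarith


/-- Let `V ⊂ ℝ²` be a one-dimensional subspace with `V + ℤ²` dense in `ℝ²`, and let
`q : ℝ² → ℝ` be a surjective linear map with kernel `V` (the quotient map
`ℝ² → ℝ²/V ≅ ℝ`).  Let `g̃` be a homeomorphism of `ℝ²` that is a lift of a torus
homeomorphism and maps each coset `x + V` onto a coset of `V`.  Then the induced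
map `G : ℝ → ℝ` with `q ∘ g̃ = G ∘ q` is affine. -/
theorem stmt15 (V : Submodule ℝ (Fin 2 → ℝ)) (hdim : Module.finrank ℝ V = 1)
    (hdense : Dense {x : Fin 2 → ℝ | ∃ v ∈ V, ∃ a : Fin 2 → ℤ,
      x = v + fun i => (a i : ℝ)})
    (q : (Fin 2 → ℝ) →ₗ[ℝ] ℝ) (hq : Function.Surjective q)
    (hker : LinearMap.ker q = V)
    (gt : (Fin 2 → ℝ) ≃ₜ (Fin 2 → ℝ))
    (hlift : ∀ x : Fin 2 → ℝ, ∀ a : Fin 2 → ℤ, ∀ i : Fin 2,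
      ∃ k : ℤ, gt (x + fun j => (a j : ℝ)) i - gt x i = k)
    (hfol : ∀ x : Fin 2 → ℝ, ∃ z : Fin 2 → ℝ,
      (fun y => gt y) '' {y | y - x ∈ V} = {y | y - z ∈ V})
    (G : ℝ → ℝ) (hG : ∀ x : Fin 2 → ℝ, G (q x) = q (gt x)) :
    ∃ a b : ℝ, ∀ t : ℝ, G t = a * t + b := by
  have hqc : Continuous q := q.continuous_of_finiteDimensional
  obtain ⟨σ, hσ⟩ := q.exists_rightInverse_of_surjective (LinearMap.range_eq_top.2 hq)
  have hqσ : ∀ t, q (σ t) = t := fun t => LinearMap.congr_fun hσ t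
  have hGc : Continuous G := by
    have hGσ : G = fun t => q (gt (σ t)) := funext fun t => by rw [← hG, hqσ]
    rw [hGσ]
    exact hqc.comp (gt.continuous.comp σ.continuous_of_finiteDimensional)
  refine hGc.affine_of_dense_increments (hq.denseRange.dense_image hqc hdense) ?_
  rintro _ ⟨_, ⟨v, hv, m, rfl⟩, rfl⟩ t
  have hqv : q v = 0 := by rwa [← hker, LinearMap.mem_ker] at hv
  have hconst : ∀ x y, gt (x + fun j => (m j : ℝ)) - gt x = gt (y + fun j => (m j : ℝ)) - gt y :=
    fun x y => funext fun i =>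
      Continuous.eq_of_forall_exists_int
        (f := fun x => gt (x + fun j => (m j : ℝ)) i - gt x i) (by fun_prop)
        (fun x => hlift x m i) x y
  have key := congrArg q (hconst (σ t) 0)
  simpa only [map_sub, ← hG, map_add, hqσ, hqv, zero_add, map_zero] using key
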